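/- Let p > 2 and let G be a finite nonabelian p-group of order p^n containing a cyclic subgroup of index p^2. Then at least one of the following holds: (a) G is metacyclic; (b) |G'| = p; (c) G' is elementary abelian of order p^2 and G is 2-generated. -/

import Mathlib

/-- A group is metacyclic if it has a cyclic normal subgroup with cyclic
quotient. -/
def IsMetacyclic (G : Type*) [Group G] : Prop :=
  ∃ N : Subgroup G, ∃ h : N.Normal, IsCyclic N ∧ (letI := h; IsCyclic (G ⧸ N))

open scoped commutatorElement

theorem Nat.succ_choose_two (k : ℕ) : (k + 1).choose 2 = k + k.choose 2 := by
  rw [Nat.choose_succ_succ' k 1, Nat.choose_one_right]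

/-- If `t` commutes with `a` and `b` and `b * a = a * b * t`, powers of `a * b` are collected as in
a group of class two. -/
theorem mul_pow_eq_of_mul_eq {H : Type*} [Group H] {a b t : H} (h : b * a = a * b * t)
    (hta : Commute t a) (htb : Commute t b) (n : ℕ) :
    (a * b) ^ n = a ^ n * b ^ n * t ^ (n.choose 2) := by
  have hb : ∀ n : ℕ, b ^ n * a = a * b ^ n * t ^ n := by
    intro n
    induction n with
    | zero => simp
    | succ k ih =>
      calc b ^ (k + 1) * a = b ^ k * (b * a) := by rw [pow_succ, mul_assoc]
        _ = (b ^ k * a) * b * t := by rw [h]; simp only [mul_assoc]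
        _ = a * b ^ k * (t ^ k * b) * t := by rw [ih]; simp only [mul_assoc]
        _ = a * b ^ (k + 1) * t ^ (k + 1) := by
          rw [(htb.pow_left k).eq, pow_succ b, pow_succ t]; simp only [mul_assoc]
  induction n with
  | zero => simp
  | succ k ih =>
    calc (a * b) ^ (k + 1) = a ^ k * b ^ k * (t ^ (k.choose 2) * (a * b)) := by
          rw [pow_succ, ih]; simp only [mul_assoc]
      _ = a ^ k * (b ^ k * a) * b * t ^ (k.choose 2) := by
          rw [((hta.mul_right htb).pow_left _).eq]; simp only [mul_assoc]
      _ = a ^ k * a * b ^ k * (t ^ k * b) * t ^ (k.choose 2) := by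
          rw [hb]; simp only [mul_assoc]
      _ = a ^ (k + 1) * b ^ (k + 1) * t ^ ((k + 1).choose 2) := by
          rw [(htb.pow_left k).eq, Nat.succ_choose_two, pow_add t, pow_succ a, pow_succ b]
          simp only [mul_assoc]

theorem Nat.Prime.dvd_choose_two {p : ℕ} (hp : p.Prime) (hp2 : 2 < p) : p ∣ p.choose 2 :=
  hp.dvd_choose_self (by norm_num) hp2

theorem mul_pow_prime_of_mul_eq {H : Type*} [Group H] {p : ℕ} (hp : p.Prime) (hp2 : 2 < p)
    {a b t : H} (h : b * a = a * b * t) (hta : Commute t a) (htb : Commute t b) (ht : t ^ p = 1) :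
    (a * b) ^ p = a ^ p * b ^ p := by
  obtain ⟨k, hk⟩ := hp.dvd_choose_two hp2
  rw [mul_pow_eq_of_mul_eq h hta htb, hk, pow_mul, ht, one_pow, mul_one]

/-- In a group of class two whose commutators have exponent an odd prime `p`, the `p`-th power map
is multiplicative. -/
theorem mul_pow_prime_of_commutator_le_center {H : Type*} [Group H] {p : ℕ} (hp : p.Prime)
    (hp2 : 2 < p) (hZ : commutator H ≤ Subgroup.center H) (hexp : ∀ t ∈ commutator H, t ^ p = 1)
    (a b : H) : (a * b) ^ p = a ^ p * b ^ p := by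
  have ht : ⁅b⁻¹, a⁻¹⁆ ∈ commutator H :=
    Subgroup.commutator_mem_commutator (Subgroup.mem_top _) (Subgroup.mem_top _)
  have hc : ∀ g, Commute ⁅b⁻¹, a⁻¹⁆ g := fun g => (Subgroup.mem_center_iff.1 (hZ ht) g).symm
  exact mul_pow_prime_of_mul_eq hp hp2 (by simp [commutatorElement_def, mul_assoc])
    (hc a) (hc b) (hexp _ ht)

/-- If `x c x⁻¹ = z c` and `x z x⁻¹ = s z` with `s` commuting with `x`, `z` and of order dividing
an odd prime `p`, then conjugation by `x ^ p` multiplies `c` by `z ^ p`. -/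
theorem conj_pow_prime {H : Type*} [Group H] {p : ℕ} (hp : p.Prime) (hp2 : 2 < p)
    {x c z s : H} (hc : x * c * x⁻¹ = z * c) (hz : x * z * x⁻¹ = s * z) (hsx : Commute s x)
    (hsz : Commute s z) (hs : s ^ p = 1) : x ^ p * c * (x ^ p)⁻¹ = z ^ p * c := by
  have key : ∀ n : ℕ, x ^ n * c * (x ^ n)⁻¹ = z ^ n * s ^ (n.choose 2) * c := by
    intro n
    induction n with
    | zero => simp
    | succ k ih =>
      calc x ^ (k + 1) * c * (x ^ (k + 1))⁻¹ = x * (x ^ k * c * (x ^ k)⁻¹) * x⁻¹ := by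
            rw [pow_succ']; simp only [mul_assoc, mul_inv_rev]
        _ = (x * z * x⁻¹) ^ k * (x * s * x⁻¹) ^ (k.choose 2) * (x * c * x⁻¹) := by
            rw [ih, conj_pow, conj_pow]; simp [mul_assoc]
        _ = (s * z) ^ k * (s ^ (k.choose 2) * z) * c := by
            rw [hz, hc, hsx.symm.eq, mul_inv_cancel_right]; simp only [mul_assoc]
        _ = s ^ k * (z ^ k * z) * s ^ (k.choose 2) * c := by
            rw [(hsz.pow_left _).eq, hsz.mul_pow]; simp only [mul_assoc]
        _ = z ^ (k + 1) * s ^ ((k + 1).choose 2) * c := by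
            rw [← pow_succ, (hsz.pow_pow k (k + 1)).eq, Nat.succ_choose_two, pow_add s]
            simp only [mul_assoc]
  obtain ⟨k, hk⟩ := hp.dvd_choose_two hp2
  rw [key, hk, pow_mul, hs, one_pow, mul_one]

/-- If two generators commute modulo a normal subgroup, it contains the commutator subgroup. -/
theorem commutator_le_of_closure_pair {H : Type*} [Group H] {a b : H}
    (hab : Subgroup.closure {a, b} = ⊤) (N : Subgroup H) [N.Normal] (h : ⁅a, b⁆ ∈ N) :
    commutator H ≤ N := by
  have hcomm : (a : H ⧸ N) * b = b * a := by
    have := (QuotientGroup.eq_one_iff _).2 h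
    rwa [← QuotientGroup.mk'_apply, map_commutatorElement, commutatorElement_eq_one_iff_mul_comm]
      at this
  have hcen : ∀ u ∈ ({a, b} : Set H), ∀ g : H, (g : H ⧸ N) * u = u * g := by
    intro u hu g
    have hle : Subgroup.closure {a, b} ≤
        (Subgroup.centralizer {(u : H ⧸ N)}).comap (QuotientGroup.mk' N) := by
      rw [Subgroup.closure_le]
      rintro v hv
      simp only [SetLike.mem_coe, Subgroup.mem_comap, Subgroup.mem_centralizer_singleton_iff,
        QuotientGroup.mk'_apply]
      rcases hu with rfl | rfl <;> rcases hv with rfl | rfl <;>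
        simp [hcomm]
    have := hle (hab ▸ Subgroup.mem_top g)
    rwa [Subgroup.mem_comap, Subgroup.mem_centralizer_singleton_iff] at this
  have hle : Subgroup.closure {a, b} ≤
      (Subgroup.center (H ⧸ N)).comap (QuotientGroup.mk' N) := by
    rw [Subgroup.closure_le]
    intro u hu
    refine Subgroup.mem_center_iff.2 fun g => ?_
    obtain ⟨g, rfl⟩ := QuotientGroup.mk_surjective g
    exact hcen u hu g
  refine Subgroup.commutator_le.2 fun g _ k _ => ?_
  have hk := Subgroup.mem_center_iff.1 (hle (hab ▸ Subgroup.mem_top k)) g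
  rw [← QuotientGroup.eq_one_iff, ← QuotientGroup.mk'_apply, map_commutatorElement,
    commutatorElement_eq_one_iff_mul_comm]
  exact hk

theorem zpowers_normal_of_commutator_le {G : Type*} [Group G] {a : G}
    (h : commutator G ≤ Subgroup.zpowers a) : (Subgroup.zpowers a).Normal :=
  Subgroup.Normal.of_commutator_le _ h

theorem isCyclic_quotient_of_closure_pair {G : Type*} [Group G] {a b : G}
    (hab : Subgroup.closure {a, b} = ⊤) (N : Subgroup G) [N.Normal] (ha : a ∈ N) :
    IsCyclic (G ⧸ N) := by
  refine ⟨(b : G ⧸ N), fun g => ?_⟩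
  obtain ⟨g, rfl⟩ := QuotientGroup.mk_surjective g
  have hle : Subgroup.closure {a, b} ≤
      (Subgroup.zpowers (b : G ⧸ N)).comap (QuotientGroup.mk' N) := by
    rw [Subgroup.closure_le]
    rintro u (rfl | rfl)
    · simp [(QuotientGroup.eq_one_iff u).2 ha, one_mem]
    · simp
  exact hle (hab ▸ Subgroup.mem_top g)

theorem Subgroup.Normal.of_le_center {G : Type*} [Group G] {N : Subgroup G}
    (h : N ≤ Subgroup.center G) : N.Normal where
  conj_mem t ht g := by
    rwa [Subgroup.mem_center_iff.1 (h ht) g, mul_inv_cancel_right]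

/-- A normal subgroup of order `p` of a finite `p`-group is central. -/
theorem le_center_of_card_eq_prime {G : Type*} [Group G] [Finite G] {p : ℕ} [hp : Fact p.Prime]
    (hG : IsPGroup p G) (N : Subgroup G) [N.Normal] (hN : Nat.card N = p) :
    N ≤ Subgroup.center G := by
  have hG' : IsPGroup p (ConjAct G) := hG
  obtain ⟨b, hb, hb1⟩ := hG'.exists_fixed_point_of_prime_dvd_card_of_fixed_point N
    (a := 1) (by rw [hN]) (by simp [MulAction.mem_fixedPoints])
  intro t ht
  have hz : (⟨t, ht⟩ : N) ∈ Subgroup.zpowers b := by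
    rw [zpowers_eq_top_of_prime_card hN hb1.symm]
    trivial
  obtain ⟨k, hk⟩ := hz
  have hbc : (b : G) ∈ Subgroup.center G := by
    refine Subgroup.mem_center_iff.2 fun g => ?_
    have := congrArg Subtype.val (hb (ConjAct.toConjAct g))
    rw [ConjAct.Subgroup.val_conj_smul, ConjAct.toConjAct_smul] at this
    exact mul_inv_eq_iff_eq_mul.1 this
  have : t = (b : G) ^ k := by simpa using (congrArg Subtype.val hk).symm
  rw [this]
  exact zpow_mem hbc k

theorem exists_le_index_eq_of_ne_top {G : Type*} [Group G] [Finite G] {p n : ℕ} (hp : p.Prime)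
    (hG : Nat.card G = p ^ (n + 1)) (K : Subgroup G) (hK : K ≠ ⊤) :
    ∃ M : Subgroup G, M.index = p ∧ K ≤ M := by
  have : Fact p.Prime := ⟨hp⟩
  obtain ⟨k, hkn, hk⟩ := (Nat.dvd_prime_pow hp).1 (hG ▸ K.card_subgroup_dvd_card)
  have hkn' : k ≤ n := by
    by_contra hlt
    have : k = n + 1 := by omega
    exact hK (Subgroup.eq_top_of_card_eq K (by rw [hk, hG, this]))
  obtain ⟨M, hM, hKM⟩ := Sylow.exists_subgroup_card_pow_prime_le p (m := n)
    (hG ▸ pow_dvd_pow p (by omega)) K hk hkn'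
  refine ⟨M, ?_, hKM⟩
  have := M.card_mul_index
  rw [hM, hG, pow_succ] at this
  exact Nat.eq_of_mul_eq_mul_left (pow_pos hp.pos n) this

theorem normal_of_index_eq_prime {G : Type*} [Group G] [Finite G] {p n : ℕ} (hp : p.Prime)
    (hG : Nat.card G = p ^ (n + 1)) (M : Subgroup G) (hM : M.index = p) : M.Normal :=
  M.normal_of_index_eq_minFac_card (by rw [hM, hG, hp.pow_minFac (by omega)])

theorem commutator_le_of_index_eq_prime {G : Type*} [Group G] {p : ℕ} (hp : p.Prime)
    (M : Subgroup G) [M.Normal] (hM : M.index = p) : commutator G ≤ M := by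
  have : Fact p.Prime := ⟨hp⟩
  have : IsCyclic (G ⧸ M) := isCyclic_of_prime_card (p := p) hM
  exact Subgroup.Normal.quotient_commutative_iff_commutator_le.1 this.isMulCommutative

/-- In a finite `p`-group, elements generating modulo the commutator subgroup generate. -/
theorem eq_top_of_sup_commutator {G : Type*} [Group G] [Finite G] {p n : ℕ} (hp : p.Prime)
    (hG : Nat.card G = p ^ (n + 1)) (K : Subgroup G) (hK : K ⊔ commutator G = ⊤) : K = ⊤ := by
  by_contra hne
  obtain ⟨M, hM, hKM⟩ := exists_le_index_eq_of_ne_top hp hG K hne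
  have := normal_of_index_eq_prime hp hG M hM
  have hle : (⊤ : Subgroup G) ≤ M := hK ▸ sup_le hKM (commutator_le_of_index_eq_prime hp M hM)
  rw [top_le_iff.1 hle, Subgroup.index_top] at hM
  exact hp.one_lt.ne hM

theorem eq_top_of_index_prime_of_notMem {G : Type*} [Group G] {p : ℕ} (hp : p.Prime)
    (M : Subgroup G) (hM : M.index = p) {K : Subgroup G} (hMK : M ≤ K) {x : G} (hx : x ∉ M)
    (hxK : x ∈ K) : K = ⊤ := by
  have hmul := Subgroup.relIndex_mul_index hMK
  rw [hM] at hmul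
  rcases (Nat.dvd_prime hp).1 ⟨_, hmul.symm.trans (mul_comm _ _)⟩ with h | h
  · exact Subgroup.index_eq_one.1 h
  · rw [h] at hmul
    have : M.relIndex K = 1 := Nat.eq_of_mul_eq_mul_right hp.pos (by rw [hmul, one_mul])
    exact absurd (Subgroup.relIndex_eq_one.1 this hxK) hx

theorem prime_dvd_sub_one_of_pow_modEq {p : ℕ} (hp : p.Prime) (hp2 : 2 < p) {m : ℕ} {r : ℤ}
    (hm : m ≠ 0) (h : (p : ℤ) ^ m ∣ r ^ p - 1) : (p : ℤ) ∣ r - 1 ∧ (p : ℤ) ^ m ∣ p * (r - 1) := by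
  have : Fact p.Prime := ⟨hp⟩
  have h1 : (p : ℤ) ∣ r - 1 := by
    have h2 : (p : ℤ) ∣ r ^ p - 1 := (dvd_pow_self _ hm).trans h
    rw [← ZMod.intCast_zmod_eq_zero_iff_dvd] at h2 ⊢
    push_cast at h2 ⊢
    rwa [ZMod.pow_card] at h2
  have hr : ¬ (p : ℤ) ∣ r := fun hr => by
    have : (p : ℤ) ∣ 1 := by simpa using dvd_sub hr h1
    exact hp.one_lt.ne' (by exact_mod_cast Int.eq_one_of_dvd_one (by positivity) this)
  refine ⟨h1, ?_⟩
  have e := Int.emultiplicity_pow_sub_pow hp (hp.odd_of_ne_two hp2.ne') (x := r) (y := 1) h1 hr p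
  rw [one_pow] at e
  rw [pow_dvd_iff_le_emultiplicity] at h ⊢
  rwa [emultiplicity_mul (Nat.prime_iff_prime_int.1 hp), Int.natCast_emultiplicity, add_comm, ← e]

theorem conj_pow_eq_zpow {H : Type*} [Group H] {g c : H} {r : ℤ} (h : g * c * g⁻¹ = c ^ r) (n : ℕ) :
    g ^ n * c * (g ^ n)⁻¹ = c ^ r ^ n := by
  induction n with
  | zero => simp
  | succ k ih =>
    calc g ^ (k + 1) * c * (g ^ (k + 1))⁻¹ = g * (g ^ k * c * (g ^ k)⁻¹) * g⁻¹ := by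
          rw [pow_succ']; simp only [mul_assoc, mul_inv_rev]
      _ = (g * c * g⁻¹) ^ r ^ k := by rw [ih, conj_zpow]
      _ = c ^ r ^ (k + 1) := by rw [h, ← zpow_mul, ← pow_succ']

theorem index_zpowers_eq_prime {H : Type*} [Group H] {p m : ℕ} (hp : p.Prime)
    (hH : Nat.card H = p ^ (m + 1)) {c : H} (hc : orderOf c = p ^ m) :
    (Subgroup.zpowers c).index = p := by
  have := (Subgroup.zpowers c).card_mul_index
  rw [Nat.card_zpowers, hc, hH, pow_succ] at this
  exact Nat.eq_of_mul_eq_mul_left (pow_pos hp.pos m) this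

theorem closure_pair_eq_top_of_notMem_zpowers {H : Type*} [Group H] {p m : ℕ} (hp : p.Prime)
    (hH : Nat.card H = p ^ (m + 1)) {c : H} (hc : orderOf c = p ^ m) {y : H}
    (hy : y ∉ Subgroup.zpowers c) : Subgroup.closure {y, c} = ⊤ :=
  eq_top_of_index_prime_of_notMem hp _ (index_zpowers_eq_prime hp hH hc)
    ((Subgroup.zpowers_le).2 (Subgroup.subset_closure (by simp))) hy
    (Subgroup.subset_closure (by simp))

/-- In a group of odd prime power order with a cyclic subgroup `⟨c⟩` of index `p`, commutators are
central of order dividing `p` and lie in `⟨c⟩`. -/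
theorem commutator_of_cyclic_index_prime {H : Type*} [Group H] [Finite H] {p m : ℕ}
    (hp : p.Prime) (hp2 : 2 < p) (hH : Nat.card H = p ^ (m + 1)) {c : H} (hc : orderOf c = p ^ m)
    {t : H} (ht : t ∈ commutator H) :
    t ∈ Subgroup.zpowers c ∧ t ^ p = 1 ∧ t ∈ Subgroup.center H := by
  have hidx := index_zpowers_eq_prime hp hH hc
  have hnorm := normal_of_index_eq_prime hp hH _ hidx
  have htC := commutator_le_of_index_eq_prime hp _ hidx ht
  refine ⟨htC, ?_⟩
  rcases m with _ | m
  · have : c = 1 := by simpa using hc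
    have : t = 1 := by simpa [this] using htC
    simp [this, one_mem]
  have hcz : ∀ k : ℤ, c ^ k = 1 ↔ (p : ℤ) ^ (m + 1) ∣ k := fun k => by
    rw [← orderOf_dvd_iff_zpow_eq_one, hc, Nat.cast_pow]
  have hconj : ∀ g : H, ∃ r : ℤ, g * c * g⁻¹ = c ^ r ∧ (p : ℤ) ∣ r - 1 ∧
      (p : ℤ) ^ (m + 1) ∣ p * (r - 1) := by
    intro g
    obtain ⟨r, hr⟩ := hnorm.conj_mem c (Subgroup.mem_zpowers c) g
    refine ⟨r, hr.symm, prime_dvd_sub_one_of_pow_modEq hp hp2 m.succ_ne_zero ?_⟩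
    obtain ⟨i, hi⟩ : g ^ p ∈ Subgroup.zpowers c := by
      have := (Subgroup.zpowers c).pow_index_mem g
      rwa [hidx] at this
    have h1 := conj_pow_eq_zpow hr.symm p
    have h2 : g ^ p * c * (g ^ p)⁻¹ = c := by
      rw [← hi]; simp only [← zpow_neg, ← zpow_add_one, ← zpow_add]; simp
    rw [← hcz, zpow_sub_one, ← h1, h2, mul_inv_cancel]
  have hN : Subgroup.zpowers (c ^ p ^ m) ≤ Subgroup.center H := by
    rw [Subgroup.zpowers_le, Subgroup.mem_center_iff]
    intro g
    obtain ⟨r, hr, hpr, -⟩ := hconj g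
    rw [← mul_inv_eq_iff_eq_mul, ← conj_pow, hr, ← zpow_natCast, ← zpow_natCast, ← zpow_mul,
      ← mul_inv_eq_one, ← zpow_neg, ← zpow_add, hcz]
    obtain ⟨k, hk⟩ := hpr
    exact ⟨k, by rw [show r = 1 + p * k by linarith]; push_cast; ring⟩
  have hNnormal : (Subgroup.zpowers (c ^ p ^ m)).Normal := Subgroup.Normal.of_le_center hN
  obtain ⟨y, hy⟩ : ∃ y, y ∉ Subgroup.zpowers c := by
    by_contra! hall
    have := (Subgroup.eq_top_iff' _).2 hall
    rw [this, Subgroup.index_top] at hidx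
    exact hp.one_lt.ne hidx
  have hle : commutator H ≤ Subgroup.zpowers (c ^ p ^ m) := by
    refine commutator_le_of_closure_pair (closure_pair_eq_top_of_notMem_zpowers hp hH hc hy) _ ?_
    obtain ⟨r, hr, -, k, hk⟩ := hconj y
    refine ⟨k, ?_⟩
    have hk' : r - 1 = p ^ m * k :=
      mul_left_cancel₀ (Nat.cast_ne_zero.2 hp.ne_zero) (hk.trans (by ring))
    rw [commutatorElement_def, hr, ← zpow_sub_one, hk', zpow_mul, ← Nat.cast_pow, zpow_natCast]
  refine ⟨?_, hN (hle ht)⟩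
  obtain ⟨k, hk⟩ := hle ht
  rw [← hk]
  change ((c ^ p ^ m) ^ k) ^ p = 1
  rw [← zpow_natCast _ p, ← zpow_natCast c, ← zpow_mul, ← zpow_mul, hcz]
  exact ⟨k, by push_cast; ring⟩

theorem mul_pow_prime_of_cyclic_index_prime {H : Type*} [Group H] [Finite H] {p m : ℕ}
    (hp : p.Prime) (hp2 : 2 < p) (hH : Nat.card H = p ^ (m + 1)) {c : H} (hc : orderOf c = p ^ m)
    (a b : H) : (a * b) ^ p = a ^ p * b ^ p :=
  mul_pow_prime_of_commutator_le_center hp hp2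
    (fun _ ht => (commutator_of_cyclic_index_prime hp hp2 hH hc ht).2.2)
    (fun _ ht => (commutator_of_cyclic_index_prime hp hp2 hH hc ht).2.1) a b

theorem exists_zpow_mul_pow_eq_one {H : Type*} [Group H] [Finite H] {p m : ℕ}
    (hp : p.Prime) (hp2 : 2 < p) (hH : Nat.card H = p ^ (m + 1)) {c : H} (hc : orderOf c = p ^ m)
    (hcyc : ¬ IsCyclic H) (g : H) : ∃ k : ℤ, (c ^ k * g) ^ p = 1 := by
  have : Fact p.Prime := ⟨hp⟩
  rcases m with _ | m
  · exact absurd (isCyclic_of_prime_card (p := p) (by simpa using hH)) hcyc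
  have hidx := index_zpowers_eq_prime hp hH hc
  have hnorm := normal_of_index_eq_prime hp hH _ hidx
  obtain ⟨i, hi⟩ : g ^ p ∈ Subgroup.zpowers c := by
    have := (Subgroup.zpowers c).pow_index_mem g
    rwa [hidx] at this
  change c ^ i = g ^ p at hi
  have hg : g ^ p ^ (m + 1) = 1 := by
    rw [← orderOf_dvd_iff_pow_eq_one]
    obtain ⟨k, hk, hk'⟩ := (Nat.dvd_prime_pow hp).1 (hH ▸ orderOf_dvd_natCard g)
    rcases hk.lt_or_eq with h | h
    · exact hk' ▸ pow_dvd_pow p (by omega)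
    · exact absurd (isCyclic_of_orderOf_eq_card g (by rw [hk', h, hH])) hcyc
  obtain ⟨k, rfl⟩ : (p : ℤ) ∣ i := by
    rw [pow_succ', pow_mul, ← hi, ← zpow_natCast, ← zpow_mul, ← orderOf_dvd_iff_zpow_eq_one, hc,
      Nat.cast_pow, Nat.cast_pow, pow_succ'] at hg
    exact (mul_dvd_mul_iff_right (by exact_mod_cast (pow_pos hp.pos m).ne')).1 hg
  refine ⟨-k, ?_⟩
  rw [mul_pow_prime_of_cyclic_index_prime hp hp2 hH hc, ← hi, ← zpow_natCast, ← zpow_mul,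
    ← zpow_add]
  simp [mul_comm]

/-- A noncyclic group of odd prime power order with a cyclic subgroup of index `p` has exactly
`p ^ 2` elements of order dividing `p`, and they form a subgroup. -/
theorem exists_subgroup_pow_prime_eq_one {H : Type*} [Group H] [Finite H] {p m : ℕ}
    (hp : p.Prime) (hp2 : 2 < p) (hH : Nat.card H = p ^ (m + 1)) {c : H} (hc : orderOf c = p ^ m)
    (hcyc : ¬ IsCyclic H) :
    ∃ E : Subgroup H, (∀ g, g ∈ E ↔ g ^ p = 1) ∧ Nat.card E = p ^ 2 := by
  have : Fact p.Prime := ⟨hp⟩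
  rcases m with _ | m
  · exact absurd (isCyclic_of_prime_card (p := p) (by simpa using hH)) hcyc
  let f : H →* H :=
    { toFun := fun g => g ^ p
      map_one' := one_pow p
      map_mul' := mul_pow_prime_of_cyclic_index_prime hp hp2 hH hc }
  refine ⟨f.ker, fun g => MonoidHom.mem_ker, ?_⟩
  have hrange : f.range = Subgroup.zpowers (c ^ p) := by
    apply le_antisymm
    · rintro _ ⟨g, rfl⟩
      obtain ⟨k, hk⟩ := exists_zpow_mul_pow_eq_one hp hp2 hH hc hcyc g
      refine ⟨-k, ?_⟩
      have hk' : f (c ^ k) * f g = 1 := by rw [← map_mul]; exact hk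
      rw [map_zpow] at hk'
      change f c ^ (-k) = f g
      rw [zpow_neg]
      exact inv_eq_of_mul_eq_one_right hk'
    · exact Subgroup.zpowers_le.2 ⟨c, rfl⟩
  have h1 := f.ker.card_mul_index
  rw [Subgroup.index_ker, hrange, Nat.card_zpowers, orderOf_pow_of_dvd hp.ne_zero
    (hc ▸ dvd_pow_self p m.succ_ne_zero), hc, hH, pow_succ, Nat.mul_div_cancel _ hp.pos] at h1
  exact Nat.eq_of_mul_eq_mul_right (pow_pos hp.pos m) (h1.trans (by ring))

theorem mem_zpowers_zpow_of_not_dvd {H : Type*} [Group H] {p n : ℕ} (hp : p.Prime) {a : H}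
    (ha : a ^ p ^ n = 1) {l : ℤ} (hl : ¬ (p : ℤ) ∣ l) : a ∈ Subgroup.zpowers (a ^ l) := by
  have hco : IsCoprime l ((p : ℤ) ^ n) :=
    (((Nat.prime_iff_prime_int.1 hp).coprime_iff_not_dvd.2 hl).symm).pow_right
  obtain ⟨u, v, huv⟩ := hco
  refine ⟨u, ?_⟩
  change (a ^ l) ^ u = a
  have : a ^ (v * (p : ℤ) ^ n) = 1 := by
    rw [mul_comm, zpow_mul, ← Nat.cast_pow, zpow_natCast, ha, one_zpow]
  calc (a ^ l) ^ u = a ^ (u * l) * a ^ (v * (p : ℤ) ^ n) := by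
        rw [this, mul_one, ← zpow_mul, mul_comm]
    _ = a := by rw [← zpow_add, huv, zpow_one]

theorem mem_zpowers_of_pow_prime_eq_one {H : Type*} [Group H] {p m : ℕ} (hp : p.Prime)
    {c t w : H} (hc : orderOf c = p ^ m) (ht : t ∈ Subgroup.zpowers c) (htp : t ^ p = 1)
    (hw : w ∈ Subgroup.zpowers c) (hwp : w ^ p = 1) (hw1 : w ≠ 1) : t ∈ Subgroup.zpowers w := by
  have : Fact p.Prime := ⟨hp⟩
  rcases m with _ | m
  · have : c = 1 := by simpa using hc
    simp_all
  have key : ∀ u ∈ Subgroup.zpowers c, u ^ p = 1 → u ∈ Subgroup.zpowers (c ^ p ^ m) := by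
    rintro _ ⟨i, rfl⟩ hu
    change (c ^ i) ^ p = 1 at hu
    rw [← zpow_natCast, ← zpow_mul, ← orderOf_dvd_iff_zpow_eq_one, hc, pow_succ] at hu
    push_cast at hu
    obtain ⟨k, rfl⟩ := (mul_dvd_mul_iff_right (Nat.cast_ne_zero.2 hp.ne_zero)).1 hu
    exact ⟨k, by simp only [← zpow_natCast, ← zpow_mul, Nat.cast_pow]⟩
  have hcard : Nat.card (Subgroup.zpowers (c ^ p ^ m)) = p := by
    rw [Nat.card_zpowers, orderOf_pow_of_dvd (pow_pos hp.pos m).ne' (hc ▸ pow_dvd_pow p m.le_succ),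
      hc, pow_succ, Nat.mul_div_cancel_left _ (pow_pos hp.pos m)]
  have hmem := mem_zpowers_of_prime_card hcard (g := ⟨w, key w hw hwp⟩) (g' := ⟨t, key t ht htp⟩)
    (by simpa [Subtype.ext_iff] using hw1)
  obtain ⟨k, hk⟩ := hmem
  exact ⟨k, by simpa using congrArg Subtype.val hk⟩

theorem isMetacyclic_of_closure_pair {G : Type*} [Group G] {a b : G}
    (hab : Subgroup.closure {a, b} = ⊤) (h : commutator G ≤ Subgroup.zpowers a) :
    IsMetacyclic G := by
  have hn := zpowers_normal_of_commutator_le h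
  exact ⟨_, hn, inferInstance, isCyclic_quotient_of_closure_pair hab _ (Subgroup.mem_zpowers a)⟩

theorem commute_mk_of_commutator_mem {G : Type*} [Group G] {W : Subgroup G} [W.Normal] {a b : G}
    (h : ⁅a, b⁆ ∈ W) : Commute (a : G ⧸ W) b := by
  have := (QuotientGroup.eq_one_iff _).2 h
  rwa [← QuotientGroup.mk'_apply, map_commutatorElement, commutatorElement_eq_one_iff_commute]
    at this

theorem mem_center_of_closure_pair {G : Type*} [Group G] {a b g : G}
    (hab : Subgroup.closure {a, b} = ⊤) (ha : Commute a g) (hb : Commute b g) :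
    g ∈ Subgroup.center G := by
  have hle : Subgroup.closure {a, b} ≤ Subgroup.centralizer {g} := by
    rw [Subgroup.closure_le]
    rintro u (rfl | rfl)
    · exact Subgroup.mem_centralizer_singleton_iff.2 ha.eq
    · exact Subgroup.mem_centralizer_singleton_iff.2 hb.eq
  exact Subgroup.mem_center_iff.2 fun k =>
    Subgroup.mem_centralizer_singleton_iff.1 (hle (hab ▸ Subgroup.mem_top k))

theorem closure_pair_mk_eq_top {G : Type*} [Group G] (W : Subgroup G) [W.Normal] {a b : G}
    (hab : Subgroup.closure {a, b} = ⊤) :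
    Subgroup.closure {(a : G ⧸ W), (b : G ⧸ W)} = ⊤ := by
  have := congrArg (Subgroup.map (QuotientGroup.mk' W)) hab
  rwa [MonoidHom.map_closure, Set.image_pair,
    Subgroup.map_top_of_surjective _ (QuotientGroup.mk'_surjective W)] at this

/-- A metacyclicity criterion for a group generated by `x` and `c` whose commutator
`z = ⁅x, c⁆` is, up to the central subgroup `⟨z ^ p⟩`, a product of `p`-th powers of powers of the
generators. -/
theorem isMetacyclic_of_commutator_eq_mul_pow {G : Type*} [Group G] {p : ℕ} (hp : p.Prime)
    (hp2 : 2 < p) {x c z : G} (hcl : Subgroup.closure {x, c} = ⊤) (hz : ⁅x, c⁆ = z)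
    (hcen : z ^ p ∈ Subgroup.center G) (hzpp : (z ^ p) ^ p = 1) (hzc : z ^ p ∈ Subgroup.zpowers c)
    (hxp : x ^ p ^ 2 = 1) (hxz : ⁅x, z⁆ ∈ Subgroup.zpowers (z ^ p))
    (hcz : ⁅c, z⁆ ∈ Subgroup.zpowers (z ^ p)) {l j : ℤ}
    (hmem : z⁻¹ * (c ^ (p * l) * x ^ (p * j)) ∈ Subgroup.zpowers (z ^ p)) :
    IsMetacyclic G := by
  set W := Subgroup.zpowers (z ^ p) with hW
  have hWc : W ≤ Subgroup.center G := Subgroup.zpowers_le.2 hcen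
  have : W.Normal := Subgroup.Normal.of_le_center hWc
  have hWz : W ≤ Subgroup.zpowers z := Subgroup.zpowers_le.2 (pow_mem (Subgroup.mem_zpowers z) p)
  have hcl' := closure_pair_mk_eq_top W hcl
  have hzcen : (z : G ⧸ W) ∈ Subgroup.center (G ⧸ W) :=
    mem_center_of_closure_pair hcl' (commute_mk_of_commutator_mem hxz)
      (commute_mk_of_commutator_mem hcz)
  have hzW : ((z : G ⧸ W)) ^ p = 1 := by
    rw [← QuotientGroup.mk_pow, QuotientGroup.eq_one_iff]
    exact Subgroup.mem_zpowers _
  have hcomm' : commutator (G ⧸ W) ≤ Subgroup.zpowers (z : G ⧸ W) := by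
    have hle : Subgroup.zpowers (z : G ⧸ W) ≤ Subgroup.center (G ⧸ W) :=
      Subgroup.zpowers_le.2 hzcen
    have := Subgroup.Normal.of_le_center hle
    refine commutator_le_of_closure_pair hcl' _ ?_
    have := map_commutatorElement (QuotientGroup.mk' W) x c
    rw [hz] at this
    exact this ▸ Subgroup.mem_zpowers _
  have hcomm : commutator G ≤ Subgroup.zpowers z := by
    intro g hg
    have hg' : (g : G ⧸ W) ∈ commutator (G ⧸ W) := by
      have := Subgroup.mem_map_of_mem (QuotientGroup.mk' W) hg
      rw [commutator_def, Subgroup.map_commutator] at this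
      exact Subgroup.commutator_mono le_top le_top this
    obtain ⟨k, hk⟩ := hcomm' hg'
    change (z : G ⧸ W) ^ k = g at hk
    rw [← QuotientGroup.mk_zpow, QuotientGroup.eq] at hk
    simpa using mul_mem (zpow_mem (Subgroup.mem_zpowers z) k) (hWz hk)
  have hxj : ∀ i : ℤ, x ^ (p * (p * i)) = 1 := fun i => by
    rw [← mul_assoc, ← Nat.cast_mul, ← sq, zpow_mul, zpow_natCast, hxp, one_zpow]
  by_cases hj : (p : ℤ) ∣ j
  · obtain ⟨i, rfl⟩ := hj
    rw [hxj, mul_one] at hmem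
    have hzc' : z ∈ Subgroup.zpowers c := by
      have h1 := Subgroup.zpowers_le.2 hzc hmem
      have h2 := mul_mem h1 (inv_mem (zpow_mem (Subgroup.mem_zpowers c) (p * l)))
      simpa using h2
    exact isMetacyclic_of_closure_pair (Set.pair_comm x c ▸ hcl)
      (hcomm.trans (Subgroup.zpowers_le.2 hzc'))
  · have hmul : (c ^ l * x ^ j : G ⧸ W) ^ p = z := by
      rw [mul_pow_prime_of_commutator_le_center hp hp2
        (hcomm'.trans (Subgroup.zpowers_le.2 hzcen))]
      · rw [QuotientGroup.eq.2 hmem]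
        simp only [QuotientGroup.mk_mul, QuotientGroup.mk_zpow, ← zpow_natCast, ← zpow_mul,
          mul_comm]
      · intro t ht
        obtain ⟨k, rfl⟩ := hcomm' ht
        change ((z : G ⧸ W) ^ k) ^ p = 1
        rw [← zpow_natCast, zpow_comm, zpow_natCast, hzW, one_zpow]
    have hv : z⁻¹ * (c ^ l * x ^ j) ^ p ∈ W := by
      rw [← QuotientGroup.eq, ← hmul]; simp
    set v := c ^ l * x ^ j with hvdef
    obtain ⟨i, hi⟩ := hv
    change (z ^ p) ^ i = z⁻¹ * v ^ p at hi
    have hvz : v ^ p = z * (z ^ p) ^ i := by rw [hi, mul_inv_cancel_left]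
    have hwv : z ^ p ∈ Subgroup.zpowers v := by
      have : (v ^ p) ^ p = z ^ p := by
        have h1 : ((z ^ p) ^ i) ^ p = 1 := by
          rw [← zpow_natCast, zpow_comm, zpow_natCast, hzpp, one_zpow]
        rw [hvz, (((Commute.refl z).pow_right p).zpow_right i).mul_pow, h1, mul_one]
      rw [← this]
      exact pow_mem (pow_mem (Subgroup.mem_zpowers v) p) p
    have hzv : z ∈ Subgroup.zpowers v := by
      have : z = v ^ p * ((z ^ p) ^ i)⁻¹ := by rw [hvz, mul_inv_cancel_right]
      rw [this]
      exact mul_mem (pow_mem (Subgroup.mem_zpowers v) p) (inv_mem (zpow_mem hwv i))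
    refine isMetacyclic_of_closure_pair (b := c) ?_ (hcomm.trans (Subgroup.zpowers_le.2 hzv))
    rw [← top_le_iff, ← hcl, Subgroup.closure_le]
    have hcK : c ∈ Subgroup.closure {v, c} := Subgroup.subset_closure (by simp)
    have hvK : v ∈ Subgroup.closure {v, c} := Subgroup.subset_closure (by simp)
    have hxK : x ^ j ∈ Subgroup.closure {v, c} := by
      have : x ^ j = (c ^ l)⁻¹ * v := by rw [hvdef, inv_mul_cancel_left]
      rw [this]
      exact mul_mem (inv_mem (zpow_mem hcK l)) hvK
    rintro u (rfl | rfl)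
    · exact Subgroup.zpowers_le.2 hxK (mem_zpowers_zpow_of_not_dvd hp hxp hj)
    · exact hcK

theorem isMetacyclic_of_isCyclic_index_prime {G : Type*} [Group G] {p : ℕ} (hp : p.Prime)
    (M : Subgroup G) [hM : M.Normal] (hMi : M.index = p) (hc : IsCyclic M) : IsMetacyclic G := by
  have : Fact p.Prime := ⟨hp⟩
  exact ⟨M, hM, hc, isCyclic_of_prime_card (p := p) hMi⟩

theorem card_map_mk_eq_prime {G : Type*} [Group G] {p : ℕ} (hp : p.Prime) {E W : Subgroup G}
    [W.Normal] (hWE : W ≤ E) (hE : Nat.card E = p ^ 2) (hW : Nat.card W = p) :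
    Nat.card (E.map (QuotientGroup.mk' W)) = p := by
  rw [← Subgroup.relIndex_ker, QuotientGroup.ker_mk']
  have h := Subgroup.relIndex_mul_relIndex ⊥ W E bot_le hWE
  rw [Subgroup.relIndex_bot_left, Subgroup.relIndex_bot_left, hE, hW, sq] at h
  exact Nat.eq_of_mul_eq_mul_left hp.pos h

/-- The situation of a finite `p`-group `G` with a maximal subgroup `M` that is noncyclic and has a
cyclic subgroup `⟨c⟩` of index `p`; `E` is the subgroup of elements of `M` of order dividing `p`. -/
structure CyclicTower {G : Type*} [Group G] (p m : ℕ) (M E : Subgroup G) (c : G) : Prop where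
  normal : M.Normal
  index : M.index = p
  mem : c ∈ M
  orderOf_eq : orderOf c = p ^ (m + 1)
  mul_pow : ∀ a ∈ M, ∀ b ∈ M, (a * b) ^ p = a ^ p * b ^ p
  exists_zpow_mul_mem : ∀ g ∈ M, ∃ k : ℤ, c ^ k * g ∈ E
  commutator_mem : ∀ a ∈ M, ∀ b ∈ M, ⁅a, b⁆ ∈ Subgroup.zpowers c ∧ ⁅a, b⁆ ^ p = 1
  mem_iff : ∀ g, g ∈ E ↔ g ∈ M ∧ g ^ p = 1
  card_eq : Nat.card E = p ^ 2

theorem exists_cyclicTower {G : Type*} [Group G] [Finite G] {p n : ℕ} (hp : p.Prime) (hp2 : 2 < p)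
    (M : Subgroup G) [hM : M.Normal] (hMi : M.index = p) (hMc : Nat.card M = p ^ (n + 1))
    (hcyc : ¬ IsCyclic M) {c : G} (hcM : c ∈ M) (hc : orderOf c = p ^ n) :
    ∃ (m : ℕ) (E : Subgroup G), n = m + 1 ∧ CyclicTower p m M E c := by
  have : Fact p.Prime := ⟨hp⟩
  rcases n with _ | m
  · exact absurd (isCyclic_of_prime_card (p := p) (by simpa using hMc)) hcyc
  have hc' : orderOf (⟨c, hcM⟩ : M) = p ^ (m + 1) := by rw [Subgroup.orderOf_mk, hc]
  obtain ⟨E, hE, hEc⟩ := exists_subgroup_pow_prime_eq_one hp hp2 hMc hc' hcyc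
  have hmem : ∀ g, g ∈ E.map M.subtype ↔ g ∈ M ∧ g ^ p = 1 := by
    intro g
    constructor
    · rintro ⟨e, he, rfl⟩
      exact ⟨e.2, by simpa using congrArg Subtype.val ((hE e).1 he)⟩
    · rintro ⟨hg, hgp⟩
      exact ⟨⟨g, hg⟩, (hE _).2 (Subtype.ext (by simpa using hgp)), rfl⟩
  refine ⟨m, E.map M.subtype, rfl, hM, hMi, hcM, hc, ?_, ?_, ?_, hmem, ?_⟩
  · intro a ha b hb
    simpa using congrArg Subtype.val
      (mul_pow_prime_of_cyclic_index_prime hp hp2 hMc hc' ⟨a, ha⟩ ⟨b, hb⟩)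
  · intro g hg
    obtain ⟨k, hk⟩ := exists_zpow_mul_pow_eq_one hp hp2 hMc hc' hcyc ⟨g, hg⟩
    exact ⟨k, (hmem _).2 ⟨mul_mem (zpow_mem hcM k) hg, by simpa using congrArg Subtype.val hk⟩⟩
  · intro a ha b hb
    have ht : ⁅(⟨a, ha⟩ : M), ⟨b, hb⟩⁆ ∈ commutator M :=
      Subgroup.commutator_mem_commutator (Subgroup.mem_top _) (Subgroup.mem_top _)
    obtain ⟨⟨k, hk⟩, h2, -⟩ := commutator_of_cyclic_index_prime hp hp2 hMc hc' ht
    exact ⟨⟨k, congrArg Subtype.val hk⟩, congrArg Subtype.val h2⟩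
  · rw [← hEc]
    exact (Nat.card_congr (E.equivMapOfInjective M.subtype M.subtype_injective).toEquiv).symm

namespace CyclicTower

variable {G : Type*} [Group G] {p m : ℕ} {M E : Subgroup G} {c : G}

theorem le (h : CyclicTower p m M E c) : E ≤ M := fun g hg => ((h.mem_iff g).1 hg).1

theorem normal_torsion (h : CyclicTower p m M E c) : E.Normal where
  conj_mem e he g := by
    obtain ⟨h1, h2⟩ := (h.mem_iff e).1 he
    exact (h.mem_iff _).2 ⟨h.normal.conj_mem e h1 g, by rw [conj_pow, h2]; simp⟩

theorem exists_notMem (h : CyclicTower p m M E c) (hp : p.Prime) : ∃ x, x ∉ M := by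
  by_contra! hall
  have := h.index
  rw [(Subgroup.eq_top_iff' M).2 hall, Subgroup.index_top] at this
  exact hp.one_lt.ne this

/-- A subgroup containing `E`, `c` and an element outside `M` is everything. -/
theorem eq_top (h : CyclicTower p m M E c) (hp : p.Prime) {K : Subgroup G} (hE : E ≤ K)
    (hc : c ∈ K) {x : G} (hx : x ∉ M) (hxK : x ∈ K) : K = ⊤ := by
  refine eq_top_of_index_prime_of_notMem hp M h.index (fun g hg => ?_) hx hxK
  obtain ⟨k, hk⟩ := h.exists_zpow_mul_mem g hg
  have := mul_mem (inv_mem (zpow_mem hc k)) (hE hk)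
  simpa using this

theorem exists_closure_pair_eq_top [Finite G] {n : ℕ} (h : CyclicTower p m M E c) (hp : p.Prime)
    (hG : Nat.card G = p ^ (n + 1)) (hE : commutator G = E) :
    ∃ a b : G, Subgroup.closure {a, b} = ⊤ := by
  obtain ⟨x, hx⟩ := h.exists_notMem hp
  refine ⟨x, c, eq_top_of_sup_commutator hp hG _ ?_⟩
  refine h.eq_top hp (hE ▸ le_sup_right) (Subgroup.mem_sup_left (Subgroup.subset_closure (by simp)))
    hx (Subgroup.mem_sup_left (Subgroup.subset_closure (by simp)))

theorem orderOf_mk (h : CyclicTower p m M E c) (hp : p.Prime) [E.Normal] :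
    orderOf (c : G ⧸ E) = p ^ m := by
  have key : ∀ k : ℕ, (c : G ⧸ E) ^ k = 1 ↔ p ^ m ∣ k := by
    intro k
    rw [← QuotientGroup.mk_pow, QuotientGroup.eq_one_iff, h.mem_iff, ← pow_mul,
      ← orderOf_dvd_iff_pow_eq_one, h.orderOf_eq, pow_succ, Nat.mul_dvd_mul_iff_right hp.pos]
    exact and_iff_right (pow_mem h.mem k)
  exact Nat.dvd_antisymm (orderOf_dvd_of_pow_eq_one ((key _).2 dvd_rfl))
    ((key _).1 (pow_orderOf_eq_one _))

theorem isMetacyclic_of_not_commutator_le [Finite G] (h : CyclicTower p m M E c) (hp : p.Prime)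
    (hp2 : 2 < p) (hG : Nat.card G = p ^ (m + 3)) (hE : ¬ commutator G ≤ E) : IsMetacyclic G := by
  have : Fact p.Prime := ⟨hp⟩
  have := h.normal
  have := h.normal_torsion
  have hpG : IsPGroup p G := IsPGroup.of_card hG
  have hQ : Nat.card (G ⧸ E) = p ^ (m + 1) := by
    have h1 := E.card_mul_index
    rw [h.card_eq, hG, show m + 3 = 2 + (m + 1) by ring, pow_add] at h1
    exact Nat.eq_of_mul_eq_mul_left (pow_pos hp.pos 2) h1
  have hcQ := h.orderOf_mk hp
  have hQcyc : ¬ IsCyclic (G ⧸ E) := fun hcyc =>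
    hE (Subgroup.Normal.quotient_commutative_iff_commutator_le.1 hcyc.isMulCommutative)
  have hcom : ∀ a b : G, ⁅a, b⁆ ∈ commutator G := fun a b =>
    Subgroup.commutator_mem_commutator (Subgroup.mem_top _) (Subgroup.mem_top _)
  obtain ⟨x, hxM, hxE⟩ : ∃ x, x ∉ M ∧ x ^ p ∈ E := by
    obtain ⟨x, hx⟩ := h.exists_notMem hp
    obtain ⟨k, hk⟩ := exists_zpow_mul_pow_eq_one hp hp2 hQ hcQ hQcyc (x : G ⧸ E)
    refine ⟨c ^ k * x, fun hmem => hx ?_, (QuotientGroup.eq_one_iff _).1 (by simpa using hk)⟩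
    exact (Subgroup.mul_mem_cancel_left M (zpow_mem h.mem k)).1 hmem
  set z := ⁅x, c⁆ with hz
  have hzM : z ∈ M := commutator_le_of_index_eq_prime hp M h.index (hcom x c)
  have hzQ : (z : G ⧸ E) = ⁅(x : G ⧸ E), (c : G ⧸ E)⁆ :=
    map_commutatorElement (QuotientGroup.mk' E) x c
  obtain ⟨hz1, hz2, hz3⟩ := commutator_of_cyclic_index_prime hp hp2 hQ hcQ
    (t := (z : G ⧸ E)) (hzQ ▸ Subgroup.commutator_mem_commutator (Subgroup.mem_top _)
      (Subgroup.mem_top _))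
  have hzE : z ∉ E := by
    intro hzE
    have hxc : (x : G ⧸ E) ∉ Subgroup.zpowers (c : G ⧸ E) := by
      rintro ⟨k, hk⟩
      change (c : G ⧸ E) ^ k = x at hk
      rw [← QuotientGroup.mk_zpow, QuotientGroup.eq] at hk
      exact hxM ((Subgroup.mul_mem_cancel_left M (inv_mem (zpow_mem h.mem k))).1 (h.le hk))
    have hbot := commutator_le_of_closure_pair
      (closure_pair_eq_top_of_notMem_zpowers hp hQ hcQ hxc) ⊥
      (by rw [← hzQ, Subgroup.mem_bot, QuotientGroup.eq_one_iff]; exact hzE)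
    refine hE (Subgroup.commutator_le.2 fun a _ b _ => ?_)
    have hab : ⁅(a : G ⧸ E), (b : G ⧸ E)⁆ ∈ commutator (G ⧸ E) :=
      Subgroup.commutator_mem_commutator (Subgroup.mem_top _) (Subgroup.mem_top _)
    exact (QuotientGroup.eq_one_iff _).1
      ((map_commutatorElement (QuotientGroup.mk' E) a b).trans (Subgroup.mem_bot.1 (hbot hab)))
  have hzpE : z ^ p ∈ E := (QuotientGroup.eq_one_iff _).1 (by simpa using hz2)
  have hzp1 : z ^ p ≠ 1 := fun h1 => hzE ((h.mem_iff z).2 ⟨hzM, h1⟩)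
  have hzpp : (z ^ p) ^ p = 1 := ((h.mem_iff _).1 hzpE).2
  have hcen : z ^ p ∈ Subgroup.center G := by
    refine Subgroup.mem_center_iff.2 fun g => ?_
    have hgz : ⁅g, z⁆ ∈ E := by
      refine (QuotientGroup.eq_one_iff _).1
        ((map_commutatorElement (QuotientGroup.mk' E) g z).trans ?_)
      exact commutatorElement_eq_one_iff_mul_comm.2 (Subgroup.mem_center_iff.1 hz3 g)
    have h1 : g * z * g⁻¹ = ⁅g, z⁆ * z := by simp [commutatorElement_def]
    have h2 := h.mul_pow _ (h.le hgz) z hzM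
    rw [← h1, conj_pow, ((h.mem_iff _).1 hgz).2, one_mul] at h2
    exact mul_inv_eq_iff_eq_mul.1 h2
  obtain ⟨l₀, hl₀⟩ := hz1
  change (c : G ⧸ E) ^ l₀ = z at hl₀
  obtain ⟨l, rfl⟩ : (p : ℤ) ∣ l₀ := by
    by_contra hl
    have hcz : (c : G ⧸ E) ∈ Subgroup.zpowers (z : G ⧸ E) := by
      rw [← hl₀]
      exact mem_zpowers_zpow_of_not_dvd (n := m) hp (by rw [← hcQ, pow_orderOf_eq_one]) hl
    have hccen := Subgroup.zpowers_le.2 hz3 hcz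
    refine hzE ((QuotientGroup.eq_one_iff _).1 (hzQ.trans ?_))
    exact commutatorElement_eq_one_iff_mul_comm.2 (Subgroup.mem_center_iff.1 hccen _)
  have he : (c ^ (p * l))⁻¹ * z ∈ E := by
    rw [← QuotientGroup.eq, QuotientGroup.mk_zpow, hl₀]
  set e := (c ^ (p * l))⁻¹ * z with hedef
  have hzce : z = c ^ (p * l) * e := (mul_inv_cancel_left _ _).symm
  have hzc : z ^ p ∈ Subgroup.zpowers c := by
    rw [hzce, h.mul_pow _ (zpow_mem h.mem _) _ (h.le he), ((h.mem_iff _).1 he).2, mul_one]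
    exact pow_mem (zpow_mem (Subgroup.mem_zpowers c) _) p
  set W := Subgroup.zpowers (z ^ p) with hW
  have hWc : W ≤ Subgroup.center G := Subgroup.zpowers_le.2 hcen
  have : W.Normal := Subgroup.Normal.of_le_center hWc
  have hWcard : Nat.card W = p := by
    rw [Nat.card_zpowers, orderOf_eq_prime hzpp hzp1]
  have hWE : W ≤ E := Subgroup.zpowers_le.2 hzpE
  have hWp : ∀ s ∈ W, s ^ p = 1 := fun s hs => ((h.mem_iff s).1 (hWE hs)).2
  have hMW : ∀ a ∈ M, ∀ b ∈ M, ⁅a, b⁆ ∈ W := fun a ha b hb => by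
    obtain ⟨h1, h2⟩ := h.commutator_mem a ha b hb
    exact mem_zpowers_of_pow_prime_eq_one hp h.orderOf_eq h1 h2 hzc hzpp hzp1
  have hEcard := card_map_mk_eq_prime hp hWE h.card_eq hWcard
  have hEnormal : (E.map (QuotientGroup.mk' W)).Normal :=
    Subgroup.Normal.map inferInstance _ (QuotientGroup.mk'_surjective W)
  have hEcen := le_center_of_card_eq_prime (hpG.to_quotient W) _ hEcard
  have hecomm : ∀ g, ∀ a ∈ E, Commute (g : G ⧸ W) (a : G ⧸ W) := fun g a ha =>
    Subgroup.mem_center_iff.1 (hEcen (Subgroup.mem_map_of_mem _ ha)) g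
  have hxcz : x * c * x⁻¹ = z * c := by simp [hz, commutatorElement_def]
  have hxz : ⁅x, z⁆ ∈ W := by
    have h1 : Commute (x : G ⧸ W) ((c ^ p : G) : G ⧸ W) := by
      refine commute_mk_of_commutator_mem ?_
      rw [commutatorElement_def, ← conj_pow, hxcz, h.mul_pow z hzM c h.mem, mul_inv_cancel_right]
      exact Subgroup.mem_zpowers _
    have h2 : Commute (x : G ⧸ W) (z : G ⧸ W) := by
      rw [hzce, zpow_mul, zpow_natCast, QuotientGroup.mk_mul, QuotientGroup.mk_zpow]
      exact (h1.zpow_right l).mul_right (hecomm x e he)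
    rw [← QuotientGroup.eq_one_iff, ← QuotientGroup.mk'_apply, map_commutatorElement,
      commutatorElement_eq_one_iff_commute]
    exact h2
  have hxW : x ^ p ∉ W := by
    intro hmem
    have hs : ∀ g, Commute ⁅x, z⁆ g := fun g => (Subgroup.mem_center_iff.1 (hWc hxz) g).symm
    have h1 := conj_pow_prime hp hp2 hxcz (s := ⁅x, z⁆) (by simp [commutatorElement_def])
      (hs x) (hs z) (hWp _ hxz)
    rw [← Subgroup.mem_center_iff.1 (hWc hmem) c, mul_inv_cancel_right] at h1
    exact hzp1 (by simpa using h1.symm)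
  have hEx : ∀ a ∈ E, ∃ j : ℤ, a⁻¹ * x ^ (p * j) ∈ W := by
    intro a ha
    obtain ⟨j, hj⟩ := mem_zpowers_of_prime_card hEcard
      (g := ⟨_, Subgroup.mem_map_of_mem _ hxE⟩) (g' := ⟨_, Subgroup.mem_map_of_mem _ ha⟩)
      (fun h1 => hxW ((QuotientGroup.eq_one_iff _).1 (congrArg Subtype.val h1)))
    refine ⟨j, ?_⟩
    have hj' : ((x ^ p : G) : G ⧸ W) ^ j = a := congrArg Subtype.val hj
    rw [← QuotientGroup.eq, ← hj', zpow_mul, zpow_natCast, QuotientGroup.mk_zpow]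
  have hcl : Subgroup.closure {x, c} = ⊤ := by
    have hcK : c ∈ Subgroup.closure {x, c} := Subgroup.subset_closure (by simp)
    have hxK : x ∈ Subgroup.closure {x, c} := Subgroup.subset_closure (by simp)
    have hWK : W ≤ Subgroup.closure {x, c} :=
      Subgroup.zpowers_le.2 (Subgroup.zpowers_le.2 hcK hzc)
    refine h.eq_top hp (fun a ha => ?_) hcK hxM hxK
    obtain ⟨j, hj⟩ := hEx a ha
    exact inv_mem_iff.1 ((Subgroup.mul_mem_cancel_right _ (zpow_mem hxK _)).1 (hWK hj))
  obtain ⟨j, hj⟩ := hEx e he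
  refine isMetacyclic_of_commutator_eq_mul_pow hp hp2 hcl hz.symm hcen hzpp hzc ?_ hxz
    (hMW c h.mem z hzM) (l := l) (j := j) ?_
  · rw [sq, pow_mul]
    exact ((h.mem_iff _).1 hxE).2
  · have hze : z⁻¹ * (c ^ (p * l) * x ^ (p * j)) = e⁻¹ * x ^ (p * j) := by
      rw [hedef, mul_inv_rev, inv_inv, mul_assoc]
    exact hze ▸ hj

end CyclicTower

/-- Let `p > 2` and let `G` be a finite nonabelian `p`-group of order `p^n`
containing a cyclic subgroup of index `p^2`. Then (a) `G` is metacyclic, or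
(b) `|G'| = p`, or (c) `G'` is elementary abelian of order `p^2` and `G` is
2-generated. -/
theorem pGroup_cyclic_index_p_sq_trichotomy
    (p n : ℕ) (hp : p.Prime) (hp2 : 2 < p)
    (G : Type*) [Group G] [Finite G] (hcard : Nat.card G = p ^ n)
    (hna : ∃ a b : G, a * b ≠ b * a)
    (C : Subgroup G) (hC : IsCyclic C) (hCi : C.index = p ^ 2) :
    IsMetacyclic G
    ∨ Nat.card (commutator G) = p
    ∨ (Nat.card (commutator G) = p ^ 2 ∧ (∀ x ∈ commutator G, x ^ p = 1)
        ∧ ∃ a b : G, Subgroup.closure {a, b} = ⊤) := by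
  have : Fact p.Prime := ⟨hp⟩
  obtain ⟨k, rfl⟩ : ∃ k, n = k + 2 := by
    have h2 : p ^ 2 ∣ p ^ n := hcard ▸ hCi ▸ C.index_dvd_card
    exact ⟨n - 2, by have := (Nat.pow_dvd_pow_iff_le_right hp.one_lt).1 h2; omega⟩
  have hCcard : Nat.card C = p ^ k := by
    have h1 := C.card_mul_index
    rw [hCi, hcard, pow_add] at h1
    exact Nat.eq_of_mul_eq_mul_right (pow_pos hp.pos 2) h1
  obtain ⟨M, hM, hCM⟩ := Sylow.exists_subgroup_card_pow_succ
    (hcard ▸ pow_dvd_pow p (by omega) : p ^ (k + 1) ∣ Nat.card G) hCcard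
  have hMi : M.index = p := by
    have h1 := M.card_mul_index
    rw [hM, hcard, pow_succ p (k + 1)] at h1
    exact Nat.eq_of_mul_eq_mul_left (pow_pos hp.pos _) h1
  have hMn : M.Normal := normal_of_index_eq_prime hp hcard M hMi
  by_cases hcyc : IsCyclic M
  · exact Or.inl (isMetacyclic_of_isCyclic_index_prime hp M hMi hcyc)
  obtain ⟨⟨c, hcC⟩, hgen⟩ := hC.exists_generator
  have hc : orderOf c = p ^ k := by
    rw [← hCcard, ← orderOf_eq_card_of_forall_mem_zpowers hgen, Subgroup.orderOf_mk]
  obtain ⟨m, E, rfl, hT⟩ := exists_cyclicTower hp hp2 M hMi hM hcyc (hCM hcC) hc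
  by_cases hE : commutator G ≤ E
  · obtain ⟨i, hi, hcardi⟩ := (Nat.dvd_prime_pow hp).1
      (hT.card_eq ▸ Subgroup.card_dvd_of_le hE)
    interval_cases i
    · obtain ⟨a, b, hab⟩ := hna
      have hbot := Subgroup.eq_bot_of_card_eq _ (hcardi.trans (pow_zero p))
      refine absurd (commutatorElement_eq_one_iff_mul_comm.1 (Subgroup.mem_bot.1 ?_)) hab
      exact hbot ▸ Subgroup.commutator_mem_commutator (Subgroup.mem_top a) (Subgroup.mem_top b)
    · exact Or.inr (Or.inl (hcardi.trans (pow_one p)))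
    · refine Or.inr (Or.inr ⟨hcardi, fun x hx => ((hT.mem_iff x).1 (hE hx)).2, ?_⟩)
      exact hT.exists_closure_pair_eq_top hp hcard
        (Subgroup.eq_of_le_of_card_ge hE (by rw [hcardi, hT.card_eq]))
  · exact Or.inl (hT.isMetacyclic_of_not_commutator_le hp hp2 hcard hE)
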